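/- arXiv:1910.06132 — 2 statements merged into one kernel-verified Lean document; each statement's English description precedes it below -/
import Mathlib

section
/- Let δ be an S¹-structure on a 𝕜-module C and k ≥ 1. For α₀ ∈ Z_{k−1} with witness family (α₁, …, α_{k−1}), set Δᵏ(α₀; α) := ∑_{i=1}^{k} δⁱ(α_{k−i}). Then: (i) δ⁰(Δᵏ(α₀; α)) = 0, i.e. Δᵏ(α₀; α) ∈ Z₀; (ii) if α and α′ are two witness families for the same α₀, then Δᵏ(α₀; α) − Δᵏ(α₀; α′) ∈ B_{k−1}; (iii) if α₀ ∈ B₀ then Δᵏ(α₀; α) ∈ B_{k−1}. Hence Δᵏ descends to a well-defined 𝕜-linear map Δᵏ : Z_{k−1}/B₀ → Z₀/B_{k−1} (of degree 1−2k when C is ℤ-graded with δⁱ of degree 1−2i). -/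
/-!
STATEMENT 5: Let δ be an S¹-structure on a 𝕜-module C and k ≥ 1.  For α₀ ∈ Z_{k−1}
with witness family (α₁, …, α_{k−1}), set Δᵏ(α₀; α) := ∑_{i=1}^{k} δⁱ(α_{k−i}).  Then:
(i) δ⁰(Δᵏ(α₀; α)) = 0, i.e. Δᵏ(α₀; α) ∈ Z₀; (ii) if α and α′ are two witness families
for the same α₀, then Δᵏ(α₀; α) − Δᵏ(α₀; α′) ∈ B_{k−1}; (iii) if α₀ ∈ B₀ then
Δᵏ(α₀; α) ∈ B_{k−1}.  Hence Δᵏ descends to a well-defined 𝕜-linear map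
Δᵏ : Z_{k−1}/B₀ → Z₀/B_{k−1}.

An element `α₀ ∈ Z_{k-1}` together with a witness family `(α₁, …, α_{k−1})` is encoded
as a function `α : ℕ → C` (with `α 0 = α₀`) satisfying the witness relations
`∑_{i=0}^{m} δⁱ(α_{m−i}) = 0` for all `m ≤ k − 1`.
-/

open Finset

variable {𝕜 : Type*} [Field 𝕜] {C : Type*} [AddCommGroup C] [Module 𝕜 C]

/-- `δ` is an `S¹`-structure: `∑_{i+j=m} δⁱ ∘ δʲ = 0` for all `m ≥ 0`. -/
def IsS1Structure (δ : ℕ → C →ₗ[𝕜] C) : Prop :=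
  ∀ m : ℕ, ∀ c : C, ∑ i ∈ Finset.range (m + 1), δ i (δ (m - i) c) = 0

/-- `B_k`: elements `α` for which there exist `α₀, …, α_k` with
`α = ∑_{i=0}^{k} δⁱ(α_{k−i})` and `∑_{i=0}^{k−j} δⁱ(α_{k−j−i}) = 0` for `1 ≤ j ≤ k`. -/
def BSet (δ : ℕ → C →ₗ[𝕜] C) (k : ℕ) : Set C :=
  {b | ∃ α : ℕ → C, b = ∑ i ∈ Finset.range (k + 1), δ i (α (k - i)) ∧
    ∀ j, 1 ≤ j → j ≤ k → ∑ i ∈ Finset.range (k - j + 1), δ i (α (k - j - i)) = 0}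

/-- The `m`-th coefficient of the operator `∑ δⁱ uⁱ` applied to the power series `∑ αⱼ uʲ`. -/
def totalCoeff (δ : ℕ → C →ₗ[𝕜] C) (α : ℕ → C) (m : ℕ) : C :=
  ∑ i ∈ Finset.range (m + 1), δ i (α (m - i))

theorem totalCoeff_totalCoeff {δ : ℕ → C →ₗ[𝕜] C} (hδ : IsS1Structure δ) (α : ℕ → C) (m : ℕ) :
    totalCoeff δ (totalCoeff δ α) m = 0 := by
  have hflip := Finset.sum_range_diag_flip (m + 1) fun i j => δ i (δ j (α (m - i - j)))
  calc totalCoeff δ (totalCoeff δ α) m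
      = ∑ i ∈ Finset.range (m + 1), ∑ j ∈ Finset.range (m + 1 - i),
          δ i (δ j (α (m - i - j))) := Finset.sum_congr rfl fun i hi => by
        rw [totalCoeff, map_sum,
          Nat.sub_add_comm (Nat.lt_succ_iff.mp (Finset.mem_range.mp hi))]
    _ = ∑ s ∈ Finset.range (m + 1), ∑ i ∈ Finset.range (s + 1),
          δ i (δ (s - i) (α (m - i - (s - i)))) := hflip.symm
    _ = 0 := Finset.sum_eq_zero fun s _ => by
        rw [← hδ s (α (m - s))]
        refine Finset.sum_congr rfl fun i hi => ?_
        have := Finset.mem_range.mp hi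
        rw [show m - i - (s - i) = m - s by omega]

theorem totalCoeff_sub (δ : ℕ → C →ₗ[𝕜] C) (α β : ℕ → C) (m : ℕ) :
    totalCoeff δ (α - β) m = totalCoeff δ α m - totalCoeff δ β m := by
  simp [totalCoeff]

theorem totalCoeff_congr (δ : ℕ → C →ₗ[𝕜] C) {α β : ℕ → C} {m : ℕ}
    (h : ∀ i ≤ m, α i = β i) : totalCoeff δ α m = totalCoeff δ β m :=
  Finset.sum_congr rfl fun i _ => by rw [h _ (Nat.sub_le m i)]

theorem totalCoeff_succ_of_zero (δ : ℕ → C →ₗ[𝕜] C) {α : ℕ → C} (h : α 0 = 0) (m : ℕ) :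
    totalCoeff δ α (m + 1) = totalCoeff δ (fun i => α (i + 1)) m := by
  rw [totalCoeff, Finset.sum_range_succ, Nat.sub_self, h, map_zero, add_zero]
  refine Finset.sum_congr rfl fun i hi => ?_
  rw [Nat.sub_add_comm (Nat.lt_succ_iff.mp (Finset.mem_range.mp hi))]

theorem totalCoeff_eq_add_sum_Icc (δ : ℕ → C →ₗ[𝕜] C) (α : ℕ → C) (k : ℕ) :
    totalCoeff δ α k = δ 0 (α k) + ∑ i ∈ Finset.Icc 1 k, δ i (α (k - i)) := by
  rw [totalCoeff, Finset.range_eq_Ico, Finset.sum_eq_sum_Ico_succ_bot k.succ_pos]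
  rfl

theorem sum_Icc_eq_totalCoeff_update (δ : ℕ → C →ₗ[𝕜] C) (α : ℕ → C) (k : ℕ) :
    ∑ i ∈ Finset.Icc 1 k, δ i (α (k - i)) = totalCoeff δ (Function.update α k 0) k := by
  rw [totalCoeff_eq_add_sum_Icc, Function.update_self, map_zero, zero_add]
  refine Finset.sum_congr rfl fun i hi => ?_
  have := Finset.mem_Icc.mp hi
  rw [Function.update_of_ne (by omega)]

theorem totalCoeff_update_of_lt (δ : ℕ → C →ₗ[𝕜] C) (α : ℕ → C) {m k : ℕ} (h : m < k) (c : C) :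
    totalCoeff δ (Function.update α k c) m = totalCoeff δ α m :=
  totalCoeff_congr δ fun _ hi => Function.update_of_ne (by omega) _ _

theorem map_zero_totalCoeff {δ : ℕ → C →ₗ[𝕜] C} (hδ : IsS1Structure δ) {α : ℕ → C} {k : ℕ}
    (h : ∀ m < k, totalCoeff δ α m = 0) : δ 0 (totalCoeff δ α k) = 0 := by
  have hD := totalCoeff_totalCoeff hδ α k
  rw [totalCoeff_eq_add_sum_Icc, Finset.sum_eq_zero, add_zero] at hD
  · exact hD
  · intro i hi
    have := Finset.mem_Icc.mp hi
    rw [h _ (by omega), map_zero]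

theorem totalCoeff_succ_mem_BSet {δ : ℕ → C →ₗ[𝕜] C} (hδ : IsS1Structure δ) {α : ℕ → C} {k : ℕ}
    (h : ∀ m ≤ k, totalCoeff δ α m = 0) {b : C} (hb : α 0 = δ 0 b) :
    totalCoeff δ α (k + 1) ∈ BSet δ k := by
  set γ : ℕ → C := α - totalCoeff δ (Pi.single 0 b) with hγ
  have hγD (m : ℕ) : totalCoeff δ γ m = totalCoeff δ α m := by
    rw [hγ, totalCoeff_sub, totalCoeff_totalCoeff hδ, sub_zero]
  have hγ0 : γ 0 = 0 := by simp [hγ, totalCoeff, hb]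
  refine ⟨fun i => γ (i + 1), ?_, fun j hj hjk => ?_⟩
  · rw [← hγD, totalCoeff_succ_of_zero δ hγ0]
    rfl
  · change totalCoeff δ (fun i => γ (i + 1)) (k - j) = 0
    rw [← totalCoeff_succ_of_zero δ hγ0, hγD]
    exact h _ (by omega)

theorem stmt_5 (δ : ℕ → C →ₗ[𝕜] C) (hδ : IsS1Structure δ) (k : ℕ) (hk : 1 ≤ k) :
    -- (i) `δ⁰(Δᵏ(α₀; α)) = 0`, i.e. `Δᵏ(α₀; α) ∈ Z₀`
    (∀ α : ℕ → C,
        (∀ m, m ≤ k - 1 → ∑ i ∈ Finset.range (m + 1), δ i (α (m - i)) = 0) →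
        δ 0 (∑ i ∈ Finset.Icc 1 k, δ i (α (k - i))) = 0) ∧
    -- (ii) independence of the witness family, up to `B_{k-1}`
    (∀ α α' : ℕ → C, α 0 = α' 0 →
        (∀ m, m ≤ k - 1 → ∑ i ∈ Finset.range (m + 1), δ i (α (m - i)) = 0) →
        (∀ m, m ≤ k - 1 → ∑ i ∈ Finset.range (m + 1), δ i (α' (m - i)) = 0) →
        (∑ i ∈ Finset.Icc 1 k, δ i (α (k - i))) -
            (∑ i ∈ Finset.Icc 1 k, δ i (α' (k - i))) ∈ BSet δ (k - 1)) ∧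
    -- (iii) `Δᵏ` vanishes on `B₀`, up to `B_{k-1}`
    (∀ α : ℕ → C,
        (∀ m, m ≤ k - 1 → ∑ i ∈ Finset.range (m + 1), δ i (α (m - i)) = 0) →
        α 0 ∈ BSet δ 0 →
        (∑ i ∈ Finset.Icc 1 k, δ i (α (k - i))) ∈ BSet δ (k - 1)) := by
  obtain ⟨k, rfl⟩ : ∃ n, k = n + 1 := ⟨k - 1, by omega⟩
  rw [Nat.add_sub_cancel]
  have vanish (α : ℕ → C)
      (h : ∀ m, m ≤ k → ∑ i ∈ Finset.range (m + 1), δ i (α (m - i)) = 0) :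
      ∀ m ≤ k, totalCoeff δ (Function.update α (k + 1) 0) m = 0 := fun m hm => by
    rw [totalCoeff_update_of_lt δ α (by omega)]
    exact h m hm
  have exact_case (α : ℕ → C)
      (h : ∀ m, m ≤ k → ∑ i ∈ Finset.range (m + 1), δ i (α (m - i)) = 0)
      (h0 : α 0 ∈ BSet δ 0) :
      (∑ i ∈ Finset.Icc 1 (k + 1), δ i (α (k + 1 - i))) ∈ BSet δ k := by
    obtain ⟨β, hβ, -⟩ := h0
    rw [sum_Icc_eq_totalCoeff_update]
    refine totalCoeff_succ_mem_BSet hδ (vanish α h) (b := β 0) ?_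
    rw [Function.update_of_ne (by omega), hβ]
    simp
  refine ⟨fun α h => ?_, fun α α' h0 h h' => ?_, exact_case⟩
  · rw [sum_Icc_eq_totalCoeff_update]
    exact map_zero_totalCoeff hδ fun m hm => vanish α h m (by omega)
  · have hsub := exact_case (α - α')
      (fun m hm => by simp [Finset.sum_sub_distrib, h m hm, h' m hm])
      ⟨0, by simp [h0], fun j _ _ => by omega⟩
    simpa [Finset.sum_sub_distrib] using hsub
end

section
/- Let δ be an S¹-structure on a 𝕜-module C and k ≥ 1. For α₀ ∈ Z_{k−1} with witness family (α₁, …, α_{k−1}), one has ∑_{i=1}^{k} δⁱ(α_{k−i}) ∈ B_{k−1} if and only if α₀ ∈ Z_k. Consequently, the kernel of the induced map Δᵏ : Z_{k−1}/B₀ → Z₀/B_{k−1} equals Z_k/B₀. -/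
/-!
STATEMENT 6: Let δ be an S¹-structure on a 𝕜-module C and k ≥ 1.  For α₀ ∈ Z_{k−1}
with witness family (α₁, …, α_{k−1}), one has ∑_{i=1}^{k} δⁱ(α_{k−i}) ∈ B_{k−1} if and
only if α₀ ∈ Z_k.  Consequently, the kernel of the induced map
Δᵏ : Z_{k−1}/B₀ → Z₀/B_{k−1} equals Z_k/B₀.
-/

open Finset

variable {𝕜 : Type*} [Field 𝕜] {C : Type*} [AddCommGroup C] [Module 𝕜 C]

/-- `Z_k`: elements `α₀` admitting a witness family `α₁, …, α_k` with
`∑_{i=0}^{m} δⁱ(α_{m−i}) = 0` for every `0 ≤ m ≤ k`. -/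
def ZSet (δ : ℕ → C →ₗ[𝕜] C) (k : ℕ) : Set C :=
  {a | ∃ α : ℕ → C, α 0 = a ∧
    ∀ m, m ≤ k → ∑ i ∈ Finset.range (m + 1), δ i (α (m - i)) = 0}

/-- The degree-`m` part `∑_{i=0}^{m} δⁱ(α_{m−i})` of the total differential, as a linear map on
families. -/
def totalDiff (δ : ℕ → C →ₗ[𝕜] C) (m : ℕ) : (ℕ → C) →ₗ[𝕜] C :=
  ∑ i ∈ Finset.range (m + 1), δ i ∘ₗ LinearMap.proj (m - i)

lemma totalDiff_apply (δ : ℕ → C →ₗ[𝕜] C) (m : ℕ) (α : ℕ → C) :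
    totalDiff δ m α = ∑ i ∈ Finset.range (m + 1), δ i (α (m - i)) := by
  simp [totalDiff]

lemma totalDiff_congr (δ : ℕ → C →ₗ[𝕜] C) {m : ℕ} {α β : ℕ → C}
    (h : ∀ i ≤ m, α i = β i) : totalDiff δ m α = totalDiff δ m β := by
  simp only [totalDiff_apply]
  exact Finset.sum_congr rfl fun i _ => by rw [h _ (Nat.sub_le m i)]

/-- On families vanishing at `0`, the total differential commutes with the index shift. -/
lemma totalDiff_succ_of_zero (δ : ℕ → C →ₗ[𝕜] C) (m : ℕ) {α : ℕ → C} (h : α 0 = 0) :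
    totalDiff δ (m + 1) α = totalDiff δ m (fun j => α (j + 1)) := by
  simp only [totalDiff_apply]
  rw [Finset.sum_range_succ, Nat.sub_self, h, map_zero, add_zero]
  refine Finset.sum_congr rfl fun i hi => ?_
  rw [Nat.sub_add_comm (Nat.lt_succ_iff.mp (Finset.mem_range.mp hi))]

lemma sum_Icc_eq_totalDiff_update (δ : ℕ → C →ₗ[𝕜] C) (k : ℕ) (α : ℕ → C) :
    ∑ i ∈ Finset.Icc 1 k, δ i (α (k - i)) = totalDiff δ k (Function.update α k 0) := by
  rw [totalDiff_apply, Finset.range_eq_Ico, Finset.sum_eq_sum_Ico_succ_bot k.succ_pos,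
    Nat.sub_zero, Function.update_self, map_zero, zero_add]
  refine Finset.sum_congr (by ext; simp) fun i hi => ?_
  have hi' : k - i ≠ k := by
    have := Finset.mem_Ico.mp hi
    omega
  rw [Function.update_of_ne hi']

lemma mem_ZSet_iff (δ : ℕ → C →ₗ[𝕜] C) (k : ℕ) (a : C) :
    a ∈ ZSet δ k ↔ ∃ α : ℕ → C, α 0 = a ∧ ∀ m ≤ k, totalDiff δ m α = 0 := by
  simp only [totalDiff_apply, ZSet, Set.mem_ofPred_eq]

lemma mem_BSet_iff (δ : ℕ → C →ₗ[𝕜] C) (k : ℕ) (b : C) :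
    b ∈ BSet δ k ↔ ∃ α : ℕ → C, b = totalDiff δ k α ∧ ∀ m < k, totalDiff δ m α = 0 := by
  simp only [totalDiff_apply, BSet, Set.mem_ofPred_eq]
  refine exists_congr fun α => and_congr_right fun _ => ⟨fun h m hm => ?_, fun h j hj hjk => ?_⟩
  · have := h (k - m) (by omega) (by omega)
    rwa [Nat.sub_sub_self hm.le] at this
  · exact h (k - j) (by omega)

theorem stmt_6 (δ : ℕ → C →ₗ[𝕜] C) (hδ : IsS1Structure δ) (k : ℕ) (hk : 1 ≤ k)
    (α : ℕ → C)
    -- `α 0 ∈ Z_{k-1}` with witness family `(α 1, …, α (k-1))`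
    (hα : ∀ m, m ≤ k - 1 → ∑ i ∈ Finset.range (m + 1), δ i (α (m - i)) = 0) :
    (∑ i ∈ Finset.Icc 1 k, δ i (α (k - i))) ∈ BSet δ (k - 1) ↔ α 0 ∈ ZSet δ k := by
  obtain ⟨n, rfl⟩ : ∃ n, k = n + 1 := ⟨k - 1, by omega⟩
  rw [Nat.add_sub_cancel] at hα ⊢
  rw [sum_Icc_eq_totalDiff_update, mem_BSet_iff, mem_ZSet_iff]
  set α' := Function.update α (n + 1) 0
  have hα'_zero : α' 0 = α 0 := Function.update_of_ne (by omega) _ _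
  have hα' : ∀ m ≤ n, totalDiff δ m α' = 0 := fun m hm => by
    rw [totalDiff_congr δ fun i hi => Function.update_of_ne (by omega) _ _, totalDiff_apply]
    exact hα m hm
  constructor
  · rintro ⟨γ, hγ, hγ_zero⟩
    let σ : ℕ → C := fun j => Nat.casesOn j 0 γ
    have hσ : ∀ m, totalDiff δ (m + 1) σ = totalDiff δ m γ := fun m =>
      totalDiff_succ_of_zero δ m rfl
    refine ⟨α' - σ, by simp [σ, hα'_zero], fun m hm => ?_⟩
    rw [map_sub, sub_eq_zero]
    rcases m with _ | m
    · rw [hα' 0 (Nat.zero_le n)]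
      simp [totalDiff_apply, σ]
    · rw [hσ]
      rcases (Nat.le_of_succ_le_succ hm).eq_or_lt with rfl | hlt
      · exact hγ
      · rw [hα' _ hlt, hγ_zero m hlt]
  · rintro ⟨β, hβ_zero, hβ⟩
    have hshift : ∀ m, totalDiff δ m (fun j => (α' - β) (j + 1)) =
        totalDiff δ (m + 1) α' - totalDiff δ (m + 1) β := fun m => by
      rw [← totalDiff_succ_of_zero δ m (by simp [hα'_zero, hβ_zero]), map_sub]
    refine ⟨fun j => (α' - β) (j + 1), ?_, fun m hm => ?_⟩
    · rw [hshift, hβ _ le_rfl, sub_zero]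
    · rw [hshift, hα' _ hm, hβ _ (by omega), sub_zero]
end
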